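/- For every even n ≥ 4, the DFA Q_n is synchronizing and its switch count equals (n² − 6n + 10)/2. -/

import Mathlib

/-- The state reached from `q` after reading the word `w`. -/
def actWord {Q σ : Type*} (δ : Q → σ → Q) (q : Q) (w : List σ) : Q :=
  w.foldl δ q

/-- A word `w` is synchronizing for the DFA with transition function `δ`:
starting in any state, after processing `w` one always ends in the same state. -/
def IsSyncWord {Q σ : Type*} (δ : Q → σ → Q) (w : List σ) : Prop :=
  ∃ qs : Q, ∀ q : Q, actWord δ q w = qs

/-- The switch count of a word: the number of maximal blocks of consecutive
equal symbols. -/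
def swc {σ : Type*} [DecidableEq σ] : List σ → ℕ
  | [] => 0
  | [_] => 1
  | a :: b :: w => (if a = b then 0 else 1) + swc (b :: w)

/-- The switch count of a synchronizing automaton: the minimal switch count of a
synchronizing word. -/
noncomputable def swOf {Q σ : Type*} [DecidableEq σ] (δ : Q → σ → Q) : ℕ :=
  sInf {k | ∃ w : List σ, IsSyncWord δ w ∧ swc w = k}

/-- The minimal length of a synchronizing word. -/
noncomputable def sslOf {Q σ : Type*} (δ : Q → σ → Q) : ℕ :=
  sInf {k | ∃ w : List σ, IsSyncWord δ w ∧ w.length = k}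

/-- Transitions of `Q_n` on state numbers `1,…,n` (`n = 2k` even), symbols
`false` (= `a`) and `true` (= `b`): `(2i)a = (2i-1)a = 2i`;
`(2i-2)b = (2i-1)b = 2i-1` for `i = 2,…,k`; `1b = 3`; `(2k)b = 1`. -/
def Qf (n x : ℕ) (s : Bool) : ℕ :=
  if s then (if x = 1 then 3 else if x = n then 1 else if x % 2 = 0 then x + 1 else x)
  else (if x % 2 = 1 then x + 1 else x)

/-- The binary automaton `Q_n` for even `n ≥ 4`, with states `{1,…,n}` encoded
as `Fin n` (state `x` is `⟨x-1, _⟩`). -/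
def Qstep (n : ℕ) (hn : 4 ≤ n) (hev : Even n) : Fin n → Bool → Fin n := fun q s =>
  ⟨Qf n ((q : ℕ) + 1) s - 1, by
    have hq := q.isLt
    obtain ⟨k, hk⟩ := hev
    unfold Qf; split_ifs <;> omega⟩

section SwitchCount

variable {σ : Type*} [DecidableEq σ]

theorem swc_cons_le (c : σ) (w : List σ) : swc (c :: w) ≤ swc w + 1 := by
  cases w with
  | nil => simp [swc]
  | cons d w => simp only [swc]; split_ifs <;> omega

theorem swc_append_le (u v : List σ) : swc (u ++ v) ≤ swc u + swc v := by
  induction u with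
  | nil => simp [swc]
  | cons c u ih =>
    cases u with
    | nil => simpa [swc, add_comm] using swc_cons_le c v
    | cons d u => simp only [List.cons_append, swc] at ih ⊢; omega

theorem one_le_swc_cons (c : σ) (w : List σ) : 1 ≤ swc (c :: w) := by
  induction w generalizing c with
  | nil => simp [swc]
  | cons d w ih => simp only [swc]; have := ih d; omega

theorem swc_le_append (u v : List σ) : swc u ≤ swc (u ++ v) := by
  induction u with
  | nil => simp [swc]
  | cons c u ih =>
    cases u with
    | nil => exact one_le_swc_cons c v
    | cons d u => simp only [List.cons_append, swc] at ih ⊢; omega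

theorem swc_flatten_replicate_le (u : List σ) (j : ℕ) :
    swc (List.replicate j u).flatten ≤ j * swc u := by
  induction j with
  | zero => simp [swc]
  | succ j ih =>
    rw [List.replicate_succ, List.flatten_cons, Nat.succ_mul]
    have := swc_append_le u (List.replicate j u).flatten
    omega

end SwitchCount

@[simp]
theorem actWord_nil {Q σ : Type*} (δ : Q → σ → Q) (q : Q) : actWord δ q [] = q := rfl

@[simp]
theorem actWord_cons {Q σ : Type*} (δ : Q → σ → Q) (q : Q) (c : σ) (w : List σ) :
    actWord δ q (c :: w) = actWord δ (δ q c) w := rfl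

theorem actWord_append {Q σ : Type*} (δ : Q → σ → Q) (q : Q) (u v : List σ) :
    actWord δ q (u ++ v) = actWord δ (actWord δ q u) v := List.foldl_append

theorem Qf_true (n x : ℕ) :
    Qf n x true = if x = 1 then 3 else if x = n then 1 else if x % 2 = 0 then x + 1 else x := rfl

theorem Qf_false (n x : ℕ) : Qf n x false = if x % 2 = 1 then x + 1 else x := rfl

theorem one_le_Qf (n x : ℕ) (c : Bool) (hx : 1 ≤ x) : 1 ≤ Qf n x c := by
  unfold Qf; split_ifs <;> omega

/-- `Qstep` is `Qf` on state numbers. -/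
theorem val_actWord_Qstep (n : ℕ) (hn : 4 ≤ n) (hev : Even n) (q : Fin n) (w : List Bool) :
    ((actWord (Qstep n hn hev) q w : Fin n) : ℕ) + 1 = actWord (Qf n) (q + 1) w := by
  induction w generalizing q with
  | nil => rfl
  | cons c w ih =>
    have h : (Qstep n hn hev q c : ℕ) + 1 = Qf n (q + 1) c := by
      have := one_le_Qf n (q + 1) c (by omega)
      simp only [Qstep]; omega
    rw [actWord_cons, actWord_cons, ih, h]

theorem one_le_actWord_Qf (n x : ℕ) (w : List Bool) (hx : 1 ≤ x) : 1 ≤ actWord (Qf n) x w := by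
  induction w generalizing x with
  | nil => exact hx
  | cons c w ih => exact ih _ (one_le_Qf n x c hx)

section LowerBound

/-- State numbers with the state `1` moved up by one turn of the cycle. -/
def liftState (n x : ℕ) : ℕ := if x = 1 then n + 1 else x

/-- Every switch advances the state by one along a cycle which is closed by turns of length
`n` or `n - 2`. -/
theorem swc_cons_add_liftState (m : ℕ) (w : List Bool) (c : Bool) (x : ℕ)
    (hx1 : 1 ≤ x) (hxn : x ≤ 2 * (m + 2)) (hc : x % 2 = if c then 1 else 0) :
    ∃ p q : ℕ, swc (c :: w) + liftState (2 * (m + 2)) x =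
      1 + liftState (2 * (m + 2)) (actWord (Qf (2 * (m + 2))) x w) +
        2 * ((m + 2) * p + (m + 1) * q) := by
  induction w generalizing c x with
  | nil => exact ⟨0, 0, by simp [swc]⟩
  | cons d w ih =>
    obtain ⟨p, q, h⟩ := ih d (Qf (2 * (m + 2)) x d)
      (one_le_Qf _ _ _ hx1)
      (by cases c <;> cases d <;> simp [Qf] at hc ⊢ <;> split_ifs <;> omega)
      (by cases c <;> cases d <;> simp [Qf] at hc ⊢ <;> split_ifs <;> omega)
    rw [actWord_cons]
    generalize liftState (2 * (m + 2)) (actWord (Qf (2 * (m + 2))) (Qf (2 * (m + 2)) x d) w)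
      = y at h ⊢
    by_cases hx : x = 1
    · subst hx
      cases c
      · simp at hc
      cases d
      · refine ⟨p + 1, q, ?_⟩
        simp [Qf, swc, liftState] at h ⊢
        linarith
      · refine ⟨p, q + 1, ?_⟩
        simp [Qf, swc, liftState] at h ⊢
        linarith
    · refine ⟨p, q, ?_⟩
      cases c <;> cases d <;>
        simp [Qf, swc, liftState, hx] at hc h ⊢ <;> split_ifs at h <;> omega

/-- The Frobenius number of `m + 2` and `m + 1` is `m * (m + 1) - 1`. -/
theorem not_representable (m p q : ℕ) : (m + 2) * p + (m + 1) * q + 1 ≠ m * (m + 1) := by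
  intro h
  rcases Nat.lt_or_ge (p + q) m with hlt | hge
  · obtain ⟨d, rfl⟩ := Nat.exists_eq_add_of_lt hlt
    nlinarith [Nat.zero_le (d * p), Nat.zero_le (d * q), Nat.zero_le (d * d)]
  · nlinarith [Nat.mul_le_mul_left (m + 1) hge]

theorem le_of_representable (m s y : ℕ) (hy : 3 ≤ y)
    (h : ∀ i, 1 ≤ i → i ≤ m + 2 →
      ∃ p q : ℕ, s + 2 * i = y + 2 * ((m + 2) * p + (m + 1) * q)) :
    2 * (m * (m + 1)) + 1 ≤ s := by
  by_contra hs
  obtain ⟨p₁, q₁, h₁⟩ := h 1 le_rfl (by omega)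
  obtain ⟨j, hj⟩ : ∃ j, (m + 2) * p₁ + (m + 1) * q₁ + j + 1 = m * (m + 1) :=
    ⟨m * (m + 1) - 1 - ((m + 2) * p₁ + (m + 1) * q₁), by omega⟩
  have hlt := Nat.mod_lt j (show 0 < m + 2 by omega)
  obtain ⟨p, q, h₂⟩ := h (j % (m + 2) + 1) (by omega) (by omega)
  have hdiv := Nat.div_add_mod j (m + 2)
  apply not_representable m (p + j / (m + 2)) q
  rw [Nat.mul_add]
  omega

/-- A word sending all even states into `{1, 2}` has a prefix sending them all to the last
state. -/
theorem exists_word_to_last (m : ℕ) (w : List Bool)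
    (h : ∀ i, 1 ≤ i → i ≤ m + 2 → actWord (Qf (2 * (m + 2))) (2 * i) w = 1 ∨
      actWord (Qf (2 * (m + 2))) (2 * i) w = 2) :
    ∃ w', swc (false :: w') ≤ swc (false :: w) ∧
      ∀ i, 1 ≤ i → i ≤ m + 2 → actWord (Qf (2 * (m + 2))) (2 * i) w' = 2 * (m + 2) := by
  induction w using List.reverseRecOn with
  | nil =>
    have h₂ := h 2 (by omega) (by omega)
    simp only [actWord_nil] at h₂
    omega
  | append_singleton w c ih =>
    simp only [actWord_append, actWord_cons, actWord_nil] at h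
    have hle : swc (false :: w) ≤ swc (false :: (w ++ [c])) := swc_le_append (false :: w) [c]
    cases c
    · obtain ⟨w', hw', h'⟩ := ih fun i h₁ h₂ => by
        have := h i h₁ h₂
        rw [Qf_false] at this
        split_ifs at this <;> omega
      exact ⟨w', hw'.trans hle, h'⟩
    · refine ⟨w, hle, fun i h₁ h₂ => ?_⟩
      have := h i h₁ h₂
      have hpos := one_le_actWord_Qf (2 * (m + 2)) (2 * i) w (by omega)
      generalize actWord (Qf (2 * (m + 2))) (2 * i) w = x at this hpos ⊢
      rw [Qf_true] at this
      split_ifs at this <;> omega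

theorem le_swc_false_cons (m y : ℕ) (w : List Bool) (hy : 1 ≤ y) (hy2 : y ≠ 2)
    (h : ∀ i, 1 ≤ i → i ≤ m + 2 → actWord (Qf (2 * (m + 2))) (2 * i) w = y) :
    2 * (m * (m + 1)) + 2 ≤ swc (false :: w) := by
  induction w with
  | nil =>
    have h₁ := h 1 le_rfl (by omega)
    have h₂ := h 2 (by omega) (by omega)
    simp only [actWord_nil] at h₁ h₂
    omega
  | cons c w ih =>
    cases c
    · have := ih fun i h₁ h₂ => by simpa [Qf] using h i h₁ h₂
      simpa [swc] using this
    · have key : 2 * (m * (m + 1)) + 1 ≤ swc (true :: w) := by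
        have step : ∀ i, 1 ≤ i → i ≤ m + 2 →
            ∃ x, 1 ≤ x ∧ x ≤ 2 * (m + 2) ∧ x % 2 = 1 ∧
              liftState (2 * (m + 2)) x = 2 * i + 1 ∧
              actWord (Qf (2 * (m + 2))) x w = y := fun i h₁ h₂ => by
          refine ⟨Qf (2 * (m + 2)) (2 * i) true, ?_, ?_, ?_, ?_, h i h₁ h₂⟩ <;>
            simp [Qf, liftState] <;> split_ifs <;> omega
        have hy3 : 3 ≤ liftState (2 * (m + 2)) y := by
          unfold liftState; split_ifs <;> omega
        refine le_of_representable m _ _ hy3 fun i h₁ h₂ => ?_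
        obtain ⟨x, hx1, hxn, hxo, hxi, hxy⟩ := step i h₁ h₂
        obtain ⟨p, q, hpq⟩ := swc_cons_add_liftState m w true x hx1 hxn (by simpa using hxo)
        rw [hxi, hxy] at hpq
        exact ⟨p, q, by omega⟩
      simp only [swc]
      simp
      omega

end LowerBound

section UpperBound

theorem actWord_rotate (n j x : ℕ) (hx : x % 2 = 0) (hx2 : 2 ≤ x) (hj : x + 2 * j ≤ n) :
    actWord (Qf n) x (List.replicate j [true, false]).flatten = x + 2 * j := by
  induction j generalizing x with
  | zero => simp
  | succ j ih =>
    have h : Qf n (Qf n x true) false = x + 2 := by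
      simp [Qf]; split_ifs <;> omega
    rw [List.replicate_succ, List.flatten_cons, actWord_append]
    simp only [actWord_cons, actWord_nil]
    rw [h, ih (x + 2) (by omega) (by omega) (by omega)]
    ring

/-- The word `b b a (b a)ᵐ`. -/
def shrinkWord (m : ℕ) : List Bool :=
  [true, true, false] ++ (List.replicate m [true, false]).flatten

theorem swc_shrinkWord_le (m : ℕ) : swc (shrinkWord m) ≤ 2 * (m + 1) := by
  have h₁ := swc_append_le [true, true, false] (List.replicate m [true, false]).flatten
  have h₂ := swc_flatten_replicate_le [true, false] m
  rw [show swc [true, true, false] = 2 from rfl] at h₁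
  rw [show swc [true, false] = 2 from rfl] at h₂
  unfold shrinkWord
  omega

theorem Qf_true_true (m x : ℕ) (hx1 : 1 ≤ x) (hx : x = 2 * (m + 2) ∨ x ≤ 3) :
    Qf (2 * (m + 2)) (Qf (2 * (m + 2)) x true) true = 3 := by
  have h : Qf (2 * (m + 2)) x true = 1 ∨ Qf (2 * (m + 2)) x true = 3 := by
    rw [Qf_true]; split_ifs <;> omega
  rcases h with h | h <;> rw [h, Qf_true]
  · simp
  · simp
    omega

theorem actWord_shrinkWord_of_le_three (m x : ℕ) (hx1 : 1 ≤ x)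
    (hx : x = 2 * (m + 2) ∨ x ≤ 3) :
    actWord (Qf (2 * (m + 2))) x (shrinkWord m) = 2 * (m + 2) := by
  have h : actWord (Qf (2 * (m + 2))) x [true, true, false] = 4 := by
    simp only [actWord_cons, actWord_nil]
    rw [Qf_true_true m x hx1 hx]
    rfl
  rw [shrinkWord, actWord_append, h, actWord_rotate _ _ _ rfl (by omega) (by omega)]
  ring

theorem actWord_shrinkWord_of_four_le (m x : ℕ) (hx : 4 ≤ x) (hxn : x < 2 * (m + 2)) :
    actWord (Qf (2 * (m + 2))) x (shrinkWord m) = 2 * (x / 2) - 2 := by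
  have h : actWord (Qf (2 * (m + 2))) x [true, true, false] = 2 * (x / 2) + 2 := by
    simp only [actWord_cons, actWord_nil]
    have h₁ : Qf (2 * (m + 2)) x true = 2 * (x / 2) + 1 := by
      simp [Qf]; split_ifs <;> omega
    have h₂ : Qf (2 * (m + 2)) (2 * (x / 2) + 1) true = 2 * (x / 2) + 1 := by
      simp [Qf]; split_ifs <;> omega
    rw [h₁, h₂]
    simp [Qf]
  have hm : m = (m + 1 - x / 2) + (1 + (x / 2 - 2)) := by omega
  have hrot : Qf (2 * (m + 2)) (Qf (2 * (m + 2)) (2 * (m + 2)) true) false = 2 := by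
    simp [Qf]
  have hsplit : (List.replicate m [true, false]).flatten =
      (List.replicate (m + 1 - x / 2) [true, false]).flatten ++
        ([true, false] ++ (List.replicate (x / 2 - 2) [true, false]).flatten) := by
    conv_lhs => rw [hm, List.replicate_add, List.replicate_add]
    simp
  rw [shrinkWord, actWord_append, h, hsplit, actWord_append,
    actWord_rotate _ _ _ (by omega) (by omega) (by omega), actWord_append,
    show 2 * (x / 2) + 2 + 2 * (m + 1 - x / 2) = 2 * (m + 2) by omega]
  simp only [actWord_cons, actWord_nil]
  rw [hrot, actWord_rotate _ _ _ (by omega) (by omega) (by omega)]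
  omega

theorem actWord_shrinkWord_pow (m j x : ℕ) (hj : j ≤ m) (hx1 : 1 ≤ x)
    (hx : x = 2 * (m + 2) ∨ x ≤ 2 * j + 3) :
    let y := actWord (Qf (2 * (m + 2))) x (List.replicate j (shrinkWord m)).flatten
    1 ≤ y ∧ (y = 2 * (m + 2) ∨ y ≤ 3) := by
  induction j generalizing x with
  | zero => exact ⟨hx1, hx⟩
  | succ j ih =>
    rw [List.replicate_succ, List.flatten_cons, actWord_append]
    by_cases h : x = 2 * (m + 2) ∨ x ≤ 3
    · rw [actWord_shrinkWord_of_le_three m x hx1 h]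
      exact ih _ (by omega) (by omega) (Or.inl rfl)
    · rw [actWord_shrinkWord_of_four_le m x (by omega) (by omega)]
      exact ih _ (by omega) (by omega) (by omega)

/-- The word `(b b a (b a)ᵐ)ᵐ b b`, a synchronizing word of `Q_{2 (m + 2)}`. -/
def syncWord (m : ℕ) : List Bool :=
  (List.replicate m (shrinkWord m)).flatten ++ [true, true]

theorem actWord_syncWord (m x : ℕ) (hx1 : 1 ≤ x) (hx : x ≤ 2 * (m + 2)) :
    actWord (Qf (2 * (m + 2))) x (syncWord m) = 3 := by
  obtain ⟨h₁, h₂⟩ := actWord_shrinkWord_pow m m x le_rfl hx1 (by omega)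
  rw [syncWord, actWord_append]
  generalize actWord (Qf (2 * (m + 2))) x (List.replicate m (shrinkWord m)).flatten = y at h₁ h₂ ⊢
  simp only [actWord_cons, actWord_nil]
  exact Qf_true_true m y h₁ h₂

theorem swc_syncWord_le (m : ℕ) : swc (syncWord m) ≤ 2 * (m * (m + 1)) + 1 := by
  have h₁ := swc_append_le (List.replicate m (shrinkWord m)).flatten [true, true]
  have h₂ := swc_flatten_replicate_le (shrinkWord m) m
  have h₃ := Nat.mul_le_mul_left m (swc_shrinkWord_le m)
  simp only [swc] at h₁
  simp at h₁
  unfold syncWord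
  linarith

end UpperBound

/-- For every even `n ≥ 4`, the DFA `Q_n` is synchronizing and its switch count
equals `(n² - 6n + 10)/2`. -/
theorem Q_sync_sw (n : ℕ) (hn : 4 ≤ n) (hev : Even n) :
    (∃ w : List Bool, IsSyncWord (Qstep n hn hev) w) ∧
      swOf (Qstep n hn hev) = (n ^ 2 + 10 - 6 * n) / 2 := by
  obtain ⟨m, rfl⟩ : ∃ m, n = 2 * (m + 2) := by
    obtain ⟨k, hk⟩ := hev
    exact ⟨k - 2, by omega⟩
  have hval : ((2 * (m + 2)) ^ 2 + 10 - 6 * (2 * (m + 2))) / 2 = 2 * (m * (m + 1)) + 1 := by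
    have : (2 * (m + 2)) ^ 2 + 10 = 2 * (2 * (m * (m + 1)) + 1) + 6 * (2 * (m + 2)) := by ring
    omega
  have hsync : IsSyncWord (Qstep _ hn hev) (syncWord m) := by
    refine ⟨⟨2, by omega⟩, fun q => Fin.ext ?_⟩
    have h := val_actWord_Qstep _ hn hev q (syncWord m)
    rw [actWord_syncWord m _ (by omega) (by omega)] at h
    exact Nat.succ_injective h
  refine ⟨⟨_, hsync⟩, ?_⟩
  rw [hval]
  have hle : swOf (Qstep _ hn hev) ≤ swc (syncWord m) := Nat.sInf_le ⟨_, hsync, rfl⟩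
  refine le_antisymm (hle.trans (swc_syncWord_le m)) ?_
  refine le_csInf ⟨swc (syncWord m), syncWord m, hsync, rfl⟩ ?_
  rintro _ ⟨w, ⟨y, hw⟩, rfl⟩
  have hy : ∀ i, 1 ≤ i → i ≤ m + 2 →
      actWord (Qf (2 * (m + 2))) (2 * i) w = y + 1 := fun i h₁ h₂ => by
    have := val_actWord_Qstep _ hn hev ⟨2 * i - 1, by omega⟩ w
    rw [hw] at this
    rw [this]
    congr 1
    simp only
    omega
  have hle := swc_cons_le false w
  by_cases hy2 : (y : ℕ) + 1 = 2
  · obtain ⟨w', hw', h'⟩ := exists_word_to_last m w fun i h₁ h₂ => Or.inr ((hy i h₁ h₂).trans hy2)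
    have := le_swc_false_cons m _ w' (by omega) (by omega) h'
    omega
  · have := le_swc_false_cons m _ w (by omega) hy2 hy
    omega
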